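/- For every n ≥ 5, the reduced Burau representation of the braid group B_n is not faithful: any group homomorphism ρ : B_n → GL_{n−1}(ℤ[t,t⁻¹]) sending each Artin generator σ_i to the i-th reduced Burau matrix B_i has a nontrivial kernel. -/

import Mathlib

open LaurentPolynomial

/-- The ring `Λ = ℤ[t,t⁻¹]` of Laurent polynomials over `ℤ`. -/
abbrev Λ : Type := LaurentPolynomial ℤ

/-- The braid relations on `m` generators `σ_1, …, σ_m` (indexed here by `Fin m`,
with index `i : Fin m` corresponding to the Artin generator `σ_{i+1}`). -/
def braidRels (m : ℕ) : Set (FreeGroup (Fin m)) :=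
  { r | (∃ i j : Fin m, (i : ℕ) + 2 ≤ (j : ℕ) ∧
          r = FreeGroup.of i * FreeGroup.of j * (FreeGroup.of i)⁻¹ * (FreeGroup.of j)⁻¹) ∨
        (∃ i j : Fin m, (i : ℕ) + 1 = (j : ℕ) ∧
          r = FreeGroup.of i * FreeGroup.of j * FreeGroup.of i *
              (FreeGroup.of j * FreeGroup.of i * FreeGroup.of j)⁻¹) }

/-- The braid group `B_n`, presented on `n - 1` generators with the braid relations. -/
abbrev BraidGroup (n : ℕ) : Type := PresentedGroup (braidRels (n - 1))

/-- The Artin generator: `σ i` corresponds to the classical `σ_{i+1}` (0-indexed). -/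
def σ {n : ℕ} (i : Fin (n - 1)) : BraidGroup n := PresentedGroup.of i

/-- The `i`-th reduced Burau matrix (0-indexed: `burauMatrix m i` is the matrix `B_{i+1}`
of the classical generator `σ_{i+1}`): it agrees with the identity except in row `i`,
where the entries are `t` in column `i-1`, `-t` in column `i`, `1` in column `i+1`. -/
noncomputable def burauMatrix (m : ℕ) (i : Fin m) : Matrix (Fin m) (Fin m) Λ :=
  fun r c =>
    if r = i then
      if (c : ℕ) + 1 = (i : ℕ) then T 1
      else if c = i then - T 1
      else if (c : ℕ) = (i : ℕ) + 1 then 1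
      else 0
    else if r = c then 1 else 0

open scoped Matrix

/-! ### The Hurwitz action

The braid group acts on sequences in a group; this detects nontrivial braids. -/

/-- The `i`-th Hurwitz move `(…, a, b, …) ↦ (…, b, b⁻¹ a b, …)` on sequences in a group. -/
def hurwitzPerm (G : Type*) [Group G] (i : ℕ) : Equiv.Perm (ℕ → G) where
  toFun f k := if k = i then f (i + 1) else
    if k = i + 1 then (f (i + 1))⁻¹ * f i * f (i + 1) else f k
  invFun f k := if k = i then f i * f (i + 1) * (f i)⁻¹ else if k = i + 1 then f i else f k
  left_inv f := by
    funext k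
    by_cases h : k = i
    · subst h; simp [mul_assoc]
    · by_cases h' : k = i + 1
      · subst h'; simp
      · simp [h, h']
  right_inv f := by
    funext k
    by_cases h : k = i
    · subst h; simp
    · by_cases h' : k = i + 1
      · subst h'; simp [mul_assoc]
      · simp [h, h']

lemma hurwitzPerm_apply {G : Type*} [Group G] (i : ℕ) (f : ℕ → G) (k : ℕ) :
    hurwitzPerm G i f k = if k = i then f (i + 1) else
      if k = i + 1 then (f (i + 1))⁻¹ * f i * f (i + 1) else f k := rfl

lemma hurwitzPerm_inv_apply {G : Type*} [Group G] (i : ℕ) (f : ℕ → G) (k : ℕ) :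
    (hurwitzPerm G i)⁻¹ f k = if k = i then f i * f (i + 1) * (f i)⁻¹ else
      if k = i + 1 then f i else f k := rfl

lemma hurwitzPerm_comm (G : Type*) [Group G] {i j : ℕ} (h : i + 2 ≤ j) :
    hurwitzPerm G i * hurwitzPerm G j = hurwitzPerm G j * hurwitzPerm G i := by
  ext f k
  simp only [Equiv.Perm.mul_apply, hurwitzPerm_apply]
  split_ifs <;> first | rfl | omega

lemma hurwitzPerm_braid (G : Type*) [Group G] (i : ℕ) :
    hurwitzPerm G i * hurwitzPerm G (i + 1) * hurwitzPerm G i =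
      hurwitzPerm G (i + 1) * hurwitzPerm G i * hurwitzPerm G (i + 1) := by
  ext f k
  simp only [Equiv.Perm.mul_apply, hurwitzPerm_apply]
  split_ifs <;> first | omega | rfl | group

/-- The Hurwitz action of the braid group on sequences in a group. -/
def hurwitzHom (G : Type*) [Group G] (n : ℕ) : BraidGroup n →* Equiv.Perm (ℕ → G) :=
  PresentedGroup.toGroup (f := fun i : Fin (n - 1) => hurwitzPerm G i) <| by
    rintro r (⟨i, j, h, rfl⟩ | ⟨i, j, h, rfl⟩)
    · simp [hurwitzPerm_comm G h]
    · simp only [map_mul, map_inv, FreeGroup.lift_apply_of, ← h, hurwitzPerm_braid]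
      simp

lemma hurwitzHom_σ (G : Type*) [Group G] {n : ℕ} (i : Fin (n - 1)) :
    hurwitzHom G n (σ i) = hurwitzPerm G i :=
  PresentedGroup.toGroup.of _

/-- The Hurwitz move of a signed letter, on finite sequences. -/
def hurwitzStep {G : Type*} [Group G] (x : Fin 4 × Bool) (v : List G) : List G :=
  let a := v.getD x.1 1
  let b := v.getD (x.1 + 1) 1
  cond x.2 ((v.set x.1 b).set (x.1 + 1) (b⁻¹ * a * b))
    ((v.set x.1 (a * b * a⁻¹)).set (x.1 + 1) a)

lemma length_hurwitzStep {G : Type*} [Group G] (x : Fin 4 × Bool) (v : List G) :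
    (hurwitzStep x v).length = v.length := by
  obtain ⟨i, _ | _⟩ := x <;> simp [hurwitzStep]

/-! ### Words in four generators -/

/-- The homomorphism from the free group on four letters to `B_n` given by the first four
Artin generators. -/
def fourGen {n : ℕ} (h : 4 ≤ n - 1) : FreeGroup (Fin 4) →* BraidGroup n :=
  FreeGroup.lift fun i => σ (Fin.castLE h i)

lemma map_fourGen_cons {n : ℕ} (h : 4 ≤ n - 1) {H : Type*} [Group H] (φ : BraidGroup n →* H)
    (x : Fin 4 × Bool) (L : List (Fin 4 × Bool)) :
    φ (fourGen h (FreeGroup.mk (x :: L))) =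
      cond x.2 (φ (σ (Fin.castLE h x.1))) (φ (σ (Fin.castLE h x.1)))⁻¹ *
        φ (fourGen h (FreeGroup.mk L)) := by
  obtain ⟨i, _ | _⟩ := x <;> simp [fourGen]

lemma map_fourGen_nil {n : ℕ} (h : 4 ≤ n - 1) {H : Type*} [Group H] (φ : BraidGroup n →* H) :
    φ (fourGen h (FreeGroup.mk [])) = 1 := by
  rw [← FreeGroup.one_eq_mk, map_one, map_one]

lemma hurwitzHom_fourGen {G : Type*} [Group G] {n : ℕ} (h : 4 ≤ n - 1) (v : List G)
    (hv : 5 ≤ v.length) (L : List (Fin 4 × Bool)) :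
    hurwitzHom G n (fourGen h (FreeGroup.mk L)) (fun k => v.getD k 1) =
        (fun k => (L.foldr hurwitzStep v).getD k 1) ∧
      5 ≤ (L.foldr hurwitzStep v).length := by
  induction L with
  | nil => simp [map_fourGen_nil, hv]
  | cons x L ih =>
    refine ⟨?_, by rw [List.foldr_cons, length_hurwitzStep]; exact ih.2⟩
    rw [map_fourGen_cons, Equiv.Perm.mul_apply, ih.1, List.foldr_cons, hurwitzHom_σ]
    have hlen := ih.2
    generalize L.foldr hurwitzStep v = u at hlen
    obtain ⟨i, _ | _⟩ := x <;> funext k <;>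
      simp only [cond_true, cond_false, hurwitzPerm_apply, hurwitzPerm_inv_apply, hurwitzStep,
        List.getD_eq_getElem?_getD, List.getElem?_set, Fin.val_castLE, List.length_set] <;>
      have := i.2 <;> split_ifs <;> first | omega | rfl

/-! ### Computing with the Burau matrices -/

/-- `consTrim a l` is `a :: l`, without a trailing zero. -/
def consTrim (a : ℤ) : List ℤ → List ℤ
  | [] => if a = 0 then [] else [a]
  | b :: l => a :: b :: l

/-- The polynomial with a given list of coefficients. -/
noncomputable def evalCoeffs : List ℤ → Λ
  | [] => 0
  | a :: l => C a + T 1 * evalCoeffs l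

lemma evalCoeffs_consTrim (a : ℤ) (l : List ℤ) :
    evalCoeffs (consTrim a l) = C a + T 1 * evalCoeffs l := by
  cases l with
  | nil => by_cases h : a = 0 <;> simp [consTrim, evalCoeffs, h]
  | cons b l => rfl

/-- Addition of coefficient lists. -/
def addCoeffs : List ℤ → List ℤ → List ℤ
  | [], q => q
  | p, [] => p
  | a :: p, b :: q => consTrim (a + b) (addCoeffs p q)

/-- Negation of coefficient lists. -/
def negCoeffs (p : List ℤ) : List ℤ := p.map Neg.neg

lemma evalCoeffs_addCoeffs (p q : List ℤ) :
    evalCoeffs (addCoeffs p q) = evalCoeffs p + evalCoeffs q := by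
  induction p, q using addCoeffs.induct with
  | case1 q => simp [addCoeffs, evalCoeffs]
  | case2 p h => cases p <;> simp [addCoeffs, evalCoeffs]
  | case3 a p b q ih =>
    rw [addCoeffs, evalCoeffs_consTrim, ih, evalCoeffs, evalCoeffs, map_add]
    ring

lemma evalCoeffs_negCoeffs (p : List ℤ) : evalCoeffs (negCoeffs p) = -evalCoeffs p := by
  induction p with
  | nil => simp [negCoeffs, evalCoeffs]
  | cons a p ih =>
    rw [negCoeffs, List.map_cons, ← negCoeffs, evalCoeffs, evalCoeffs, ih, map_neg]
    ring

/-- The action of a signed letter on column vectors, where a negative letter acts as `t` times the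
inverse Burau matrix. The entry with index `c` is stored at position `c + 1`. -/
def burauStep (x : Fin 4 × Bool) (v : List (List ℤ)) : List (List ℤ) :=
  let a := v.getD x.1 []
  let b := v.getD (x.1 + 1) []
  let c := v.getD (x.1 + 2) []
  cond x.2 (v.set (x.1 + 1) (addCoeffs (consTrim 0 (addCoeffs a (negCoeffs b))) c))
    ((v.map (consTrim 0)).set (x.1 + 1) (addCoeffs (consTrim 0 a) (addCoeffs c (negCoeffs b))))

/-- The entries of a vector of coefficient lists. -/
noncomputable def evalEntry (v : List (List ℤ)) (k : ℕ) : Λ := evalCoeffs (v.getD k [])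

lemma evalEntry_burauStep_true (i : Fin 4) {v : List (List ℤ)} (hv : 5 ≤ v.length) (k : ℕ) :
    evalEntry (burauStep (i, true) v) k =
      if k = i + 1 then T 1 * evalEntry v i - T 1 * evalEntry v (i + 1) + evalEntry v (i + 2)
      else evalEntry v k := by
  have := i.2
  simp only [evalEntry, burauStep, cond_true, List.getD_eq_getElem?_getD, List.getElem?_set]
  split_ifs <;> first | omega | skip
  · simp only [Option.getD_some, evalCoeffs_addCoeffs, evalCoeffs_consTrim, evalCoeffs_negCoeffs,
      map_zero]
    ring
  · rfl

lemma evalEntry_burauStep_false (i : Fin 4) {v : List (List ℤ)} (hv : 5 ≤ v.length) (k : ℕ) :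
    evalEntry (burauStep (i, false) v) k =
      if k = i + 1 then T 1 * evalEntry v i + evalEntry v (i + 2) - evalEntry v (i + 1)
      else T 1 * evalEntry v k := by
  have := i.2
  simp only [evalEntry, burauStep, cond_false, List.getD_eq_getElem?_getD, List.getElem?_set,
    List.length_map, List.getElem?_map]
  split_ifs <;> first | omega | skip
  · simp only [Option.getD_some, evalCoeffs_addCoeffs, evalCoeffs_consTrim, evalCoeffs_negCoeffs,
      map_zero]
    ring
  · cases v[k]? <;> simp [evalCoeffs_consTrim, evalCoeffs]

lemma length_burauStep (x : Fin 4 × Bool) (v : List (List ℤ)) :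
    (burauStep x v).length = v.length := by
  obtain ⟨i, _ | _⟩ := x <;> simp [burauStep]

/-- A vector of coefficient lists representing an element of `Λ ^ m`. -/
def IsAdmissible (m : ℕ) (v : List (List ℤ)) : Prop :=
  5 ≤ v.length ∧ evalEntry v 0 = 0 ∧ evalEntry v (m + 1) = 0

lemma IsAdmissible.burauStep {m : ℕ} (hm : 4 ≤ m) {v : List (List ℤ)} (hv : IsAdmissible m v)
    (x : Fin 4 × Bool) : IsAdmissible m (burauStep x v) := by
  obtain ⟨h1, h2, h3⟩ := hv
  obtain ⟨i, _ | _⟩ := x <;> have := i.2 <;> refine ⟨by rwa [length_burauStep], ?_, ?_⟩ <;>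
    simp only [evalEntry_burauStep_true _ h1, evalEntry_burauStep_false _ h1] <;>
    rw [if_neg (by omega)] <;> simp [h2, h3]

lemma burauMatrix_mulVec_of_ne {m : ℕ} {i r : Fin m} (h : r ≠ i) (f : Fin m → Λ) :
    (burauMatrix m i *ᵥ f) r = f r := by
  simp [Matrix.mulVec, dotProduct, burauMatrix, h]

lemma burauMatrix_mulVec_self {m : ℕ} (i : Fin m) (f : ℕ → Λ) (h0 : f 0 = 0)
    (hm : f (m + 1) = 0) :
    (burauMatrix m i *ᵥ fun c => f (c + 1)) i =
      T 1 * f i - T 1 * f (i + 1) + f (i + 2) := by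
  have key : (burauMatrix m i *ᵥ fun c => f (c + 1)) i =
      ∑ c ∈ Finset.range m, ((if c + 1 = i then T 1 * f i else 0) +
        (if c = i then - T 1 * f (i + 1) else 0) + (if c = i + 1 then f (i + 2) else 0)) := by
    rw [Finset.sum_range, Matrix.mulVec, dotProduct]
    refine Finset.sum_congr rfl fun c _ => ?_
    simp only [burauMatrix, if_true, Fin.ext_iff]
    split_ifs <;> first | omega | simp_all
  rw [key, Finset.sum_add_distrib, Finset.sum_add_distrib]
  obtain ⟨i, hi⟩ := i
  have e2 : (∑ c ∈ Finset.range m, if c = i then - T 1 * f (i + 1) else 0) =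
      - T 1 * f (i + 1) := by simp [hi]
  have e3 : (∑ c ∈ Finset.range m, if c = i + 1 then f (i + 2) else 0) = f (i + 2) := by
    rcases Nat.lt_or_ge (i + 1) m with h | h
    · simp [h]
    · obtain rfl : m = i + 1 := by omega
      simp [hm]
  have e1 : (∑ c ∈ Finset.range m, if c + 1 = i then T 1 * f i else 0) = T 1 * f i := by
    cases i with
    | zero => simp [h0]
    | succ j => simp [Nat.lt_of_succ_lt hi]
  simp only [e1, e2, e3]
  ring

lemma burauMatrix_mulVec_burauStep_true {m : ℕ} (hm : 4 ≤ m) {v : List (List ℤ)}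
    (hv : IsAdmissible m v) (i : Fin 4) :
    (burauMatrix m (Fin.castLE hm i) *ᵥ fun c => evalEntry v (c + 1)) =
      fun c : Fin m => evalEntry (burauStep (i, true) v) (c + 1) := by
  funext r
  rw [evalEntry_burauStep_true i hv.1]
  split_ifs with h
  · obtain rfl : r = Fin.castLE hm i := by ext; simpa using h
    exact burauMatrix_mulVec_self _ _ hv.2.1 hv.2.2
  · exact burauMatrix_mulVec_of_ne (fun h' => h (by simp [h'])) _

lemma burauMatrix_mulVec_burauStep_false {m : ℕ} (hm : 4 ≤ m) {v : List (List ℤ)}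
    (hv : IsAdmissible m v) (i : Fin 4) :
    (burauMatrix m (Fin.castLE hm i) *ᵥ
        fun c => evalEntry (burauStep (i, false) v) (c + 1)) =
      (T 1 : Λ) • fun c : Fin m => evalEntry v (c + 1) := by
  have hs := hv.burauStep hm (i, false)
  funext r
  by_cases h : r = Fin.castLE hm i
  · subst h
    rw [burauMatrix_mulVec_self _ _ hs.2.1 hs.2.2]
    simp only [evalEntry_burauStep_false i hv.1, Fin.val_castLE, Pi.smul_apply, smul_eq_mul]
    rw [if_neg (by omega), if_pos trivial, if_neg (by omega)]
    ring
  · rw [burauMatrix_mulVec_of_ne h, evalEntry_burauStep_false i hv.1, if_neg]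
    · rfl
    · intro h'
      exact h (by ext; simpa using h')

lemma burau_fourGen_mulVec {n : ℕ} (ρ : BraidGroup n →* GL (Fin (n - 1)) Λ)
    (hρ : ∀ i : Fin (n - 1),
      (ρ (σ i) : Matrix (Fin (n - 1)) (Fin (n - 1)) Λ) = burauMatrix (n - 1) i)
    (h : 4 ≤ n - 1)
    {v : List (List ℤ)} (hv : IsAdmissible (n - 1) v)
    (L : List (Fin 4 × Bool)) :
    ((T 1 : Λ) ^ L.countP (fun x => !x.2) •
        ((ρ (fourGen h (FreeGroup.mk L))).val *ᵥ fun c => evalEntry v (c + 1)) =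
      fun c : Fin (n - 1) => evalEntry (L.foldr burauStep v) (c + 1)) ∧
    IsAdmissible (n - 1) (L.foldr burauStep v) := by
  induction L with
  | nil => simp [map_fourGen_nil, hv]
  | cons x L ih =>
    obtain ⟨ih, hadm⟩ := ih
    refine ⟨?_, hadm.burauStep h x⟩
    rw [map_fourGen_cons, List.foldr_cons, Units.val_mul, ← Matrix.mulVec_mulVec,
      List.countP_cons, pow_add, mul_comm, mul_smul, ← Matrix.mulVec_smul, ih]
    generalize L.foldr burauStep v = u at hadm
    obtain ⟨i, _ | _⟩ := x
    · have key := burauMatrix_mulVec_burauStep_false h hadm i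
      rw [← hρ] at key
      simp only [Bool.not_false, if_true, pow_one, cond_false]
      rw [← Matrix.mulVec_smul, ← key, Matrix.mulVec_mulVec, ← Units.val_mul, inv_mul_cancel,
        Units.val_one, Matrix.one_mulVec]
    · simp [hρ, burauMatrix_mulVec_burauStep_true h hadm i]

lemma burau_fourGen_mulVec_single {n : ℕ} (ρ : BraidGroup n →* GL (Fin (n - 1)) Λ)
    (hρ : ∀ i : Fin (n - 1),
      (ρ (σ i) : Matrix (Fin (n - 1)) (Fin (n - 1)) Λ) = burauMatrix (n - 1) i)
    (h : 4 ≤ n - 1)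
    (L : List (Fin 4 × Bool)) {c : Fin (n - 1)} (hc : 5 ≤ (c : ℕ)) :
    (ρ (fourGen h (FreeGroup.mk L))).val *ᵥ Pi.single c 1 = Pi.single c 1 := by
  have key (i : Fin 4) :
      (ρ (σ (Fin.castLE h i))).val *ᵥ Pi.single c 1 = Pi.single c 1 := by
    have := i.2
    rw [hρ]
    funext r
    rw [Matrix.mulVec_single_one, Matrix.col_apply, burauMatrix, Pi.single_apply]
    simp only [Fin.ext_iff, Fin.val_castLE]
    split_ifs <;> first | omega | rfl
  induction L with
  | nil => rw [map_fourGen_nil, Units.val_one, Matrix.one_mulVec]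
  | cons x L ih =>
    rw [map_fourGen_cons, Units.val_mul, ← Matrix.mulVec_mulVec, ih]
    obtain ⟨i, _ | _⟩ := x
    · conv_lhs => rw [← key i]
      rw [cond_false, Matrix.mulVec_mulVec, ← Units.val_mul, inv_mul_cancel, Units.val_one,
        Matrix.one_mulVec]
    · exact key i

/-- Two words in the first four generators have the same Burau matrix as soon as they act in the
same way on the first five basis vectors. -/
lemma burau_fourGen_eq {n : ℕ} (ρ : BraidGroup n →* GL (Fin (n - 1)) Λ)
    (hρ : ∀ i : Fin (n - 1),
      (ρ (σ i) : Matrix (Fin (n - 1)) (Fin (n - 1)) Λ) = burauMatrix (n - 1) i)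
    (h : 4 ≤ n - 1)
    {L L' : List (Fin 4 × Bool)}
    (hcount : L.countP (fun x => !x.2) = L'.countP (fun x => !x.2))
    (hfold : ∀ c < 5, L.foldr burauStep ((List.replicate 6 []).set (c + 1) [1]) =
      L'.foldr burauStep ((List.replicate 6 []).set (c + 1) [1])) :
    ρ (fourGen h (FreeGroup.mk L)) = ρ (fourGen h (FreeGroup.mk L')) := by
  refine Units.ext (Matrix.ext_of_mulVec_single fun c => ?_)
  rcases Nat.lt_or_ge c 5 with hc | hc
  · have hentry (k : ℕ) : evalEntry ((List.replicate 6 []).set (c + 1) [1]) k =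
        if k = c + 1 then 1 else 0 := by
      simp only [evalEntry, List.getD_eq_getElem?_getD, List.getElem?_set, List.length_replicate,
        List.getElem?_replicate]
      split_ifs <;> first | omega | simp [evalCoeffs]
    have hv : IsAdmissible (n - 1) ((List.replicate 6 []).set (c + 1) [1]) := by
      refine ⟨by simp, ?_, ?_⟩ <;> rw [hentry, if_neg]
      · omega
      · have := c.2
        omega
    have hsingle : (fun k : Fin (n - 1) =>
        evalEntry ((List.replicate 6 []).set (c + 1) [1]) (k + 1)) = Pi.single c 1 := by
      funext k
      rw [hentry, Pi.single_apply]
      simp [Fin.ext_iff]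
    have e := (burau_fourGen_mulVec ρ hρ h hv L).1
    have e' := (burau_fourGen_mulVec ρ hρ h hv L').1
    rw [hfold c hc, ← e', hcount, hsingle] at e
    exact ((isUnit_T 1).pow _).smul_left_cancel.1 e
  · rw [burau_fourGen_mulVec_single ρ hρ h L hc, burau_fourGen_mulVec_single ρ hρ h L' hc]

/-! ### Bigelow's commutator -/

/-- The conjugate `ψ₁⁻¹ σ₄ ψ₁` with `ψ₁ = σ₃⁻¹ σ₂ σ₁² σ₂ σ₄³ σ₃ σ₂`. -/
def bigelowLeft : List (Fin 4 × Bool) :=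
  let ψ : List (Fin 4 × Bool) :=
    [(2, false), (1, true), (0, true), (0, true), (1, true), (3, true), (3, true), (3, true),
     (2, true), (1, true)]
  FreeGroup.invRev ψ ++ (3, true) :: ψ

/-- The conjugate `ψ₂⁻¹ σ₄ σ₃ σ₂ σ₁² σ₂ σ₃ σ₄ ψ₂` with
`ψ₂ = σ₄⁻¹ σ₃ σ₂ σ₁⁻² σ₂ σ₁² σ₂² σ₁ σ₄⁵`. -/
def bigelowRight : List (Fin 4 × Bool) :=
  let ψ : List (Fin 4 × Bool) :=
    [(3, false), (2, true), (1, true), (0, false), (0, false), (1, true), (0, true), (0, true),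
     (1, true), (1, true), (0, true), (3, true), (3, true), (3, true), (3, true), (3, true)]
  FreeGroup.invRev ψ ++
    [(3, true), (2, true), (1, true), (0, true), (0, true), (1, true), (2, true), (3, true)] ++ ψ

lemma foldr_burauStep_bigelow : ∀ c < 5,
    (bigelowLeft ++ bigelowRight).foldr burauStep ((List.replicate 6 []).set (c + 1) [1]) =
      (bigelowRight ++ bigelowLeft).foldr burauStep
        ((List.replicate 6 []).set (c + 1) [1]) := by
  decide +kernel

lemma foldr_hurwitzStep_bigelow :
    let v : List (DihedralGroup 3) := [.sr 0, .sr 1, .sr 0, 1, .sr 2]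
    ((bigelowLeft ++ bigelowRight).foldr hurwitzStep v).getD 0 1 ≠
      ((bigelowRight ++ bigelowLeft).foldr hurwitzStep v).getD 0 1 := by
  decide +kernel

/-- For every `n ≥ 5`, the reduced Burau representation of `B_n` is not faithful. -/
theorem burau_not_faithful_of_five_le
    (n : ℕ) (hn : 5 ≤ n)
    (ρ : BraidGroup n →* GL (Fin (n - 1)) Λ)
    (hρ : ∀ i : Fin (n - 1),
      (ρ (σ i) : Matrix (Fin (n - 1)) (Fin (n - 1)) Λ) = burauMatrix (n - 1) i) :
    ∃ w : BraidGroup n, w ≠ 1 ∧ ρ w = 1 := by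
  have h : 4 ≤ n - 1 := by omega
  refine ⟨fourGen h (FreeGroup.mk (bigelowLeft ++ bigelowRight)) *
    (fourGen h (FreeGroup.mk (bigelowRight ++ bigelowLeft)))⁻¹, fun hw => ?_, ?_⟩
  · let v : List (DihedralGroup 3) := [.sr 0, .sr 1, .sr 0, 1, .sr 2]
    have e := (hurwitzHom_fourGen h v le_rfl (bigelowLeft ++ bigelowRight)).1
    rw [mul_inv_eq_one.1 hw, (hurwitzHom_fourGen h v le_rfl _).1] at e
    exact foldr_hurwitzStep_bigelow (congrFun e 0).symm
  · rw [map_mul, map_inv, mul_inv_eq_one]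
    exact burau_fourGen_eq ρ hρ h (by simp only [List.countP_append, add_comm])
      foldr_burauStep_bigelow
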